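/- Lipschitz continuity of the softmax map: for all y, y′ : A → ℝ, ( Σ_a (σ(y)(a) − σ(y′)(a))² )^{1/2} ≤ (1/ε) ( Σ_a (y(a) − y′(a))² )^{1/2}; that is, σ is (1/ε)-Lipschitz with respect to the Euclidean norm. -/

import Mathlib

open scoped BigOperators

noncomputable section

/-- Softmax choice map with regularization parameter `ε`:
`σ(y)(a) = exp(y a / ε) / ∑_b exp(y b / ε)`. -/
def softmax {A : Type*} [Fintype A] (ε : ℝ) (y : A → ℝ) (a : A) : ℝ :=
  Real.exp (y a / ε) / ∑ b, Real.exp (y b / ε)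

/-- Negative Gibbs entropy `H(p) = ∑_a p a * log (p a)` (with `0 · log 0 = 0`). -/
def negEnt {A : Type*} [Fintype A] (p : A → ℝ) : ℝ := ∑ a, p a * Real.log (p a)

theorem sm_aux1 (p q : ℝ) (hp : 0 < p) (hq : 0 < q) (hp1 : p ≤ 1) (h : q ≤ p) :
    (p - q) ^ 2 ≤ (p - q) * (Real.log p - Real.log q) := by
  have h1 := Real.log_le_sub_one_of_pos (div_pos hq hp)
  rw [Real.log_div hq.ne' hp.ne'] at h1
  have h2 : p - q ≤ (p - q) / p := by
    rw [le_div_iff₀ hp]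
    nlinarith
  have h3 : (p - q) / p = 1 - q / p := by
    field_simp
  rw [sq]
  exact mul_le_mul_of_nonneg_left (by linarith) (by linarith)

theorem sm_aux (p q : ℝ) (hp : 0 < p) (hq : 0 < q) (hp1 : p ≤ 1) (hq1 : q ≤ 1) :
    (p - q) ^ 2 ≤ (p - q) * (Real.log p - Real.log q) := by
  rcases le_total q p with h | h
  · exact sm_aux1 p q hp hq hp1 h
  · have := sm_aux1 q p hq hp hq1 h
    nlinarith

theorem sm_Z {A : Type*} [Fintype A] [Nonempty A] (ε : ℝ) (y : A → ℝ) :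
    0 < ∑ b, Real.exp (y b / ε) :=
  Finset.sum_pos (fun _ _ => Real.exp_pos _) Finset.univ_nonempty

theorem sm_pos {A : Type*} [Fintype A] [Nonempty A] (ε : ℝ) (y : A → ℝ) (a : A) :
    0 < softmax ε y a := div_pos (Real.exp_pos _) (sm_Z ε y)

theorem sm_sum {A : Type*} [Fintype A] [Nonempty A] (ε : ℝ) (y : A → ℝ) :
    ∑ a, softmax ε y a = 1 := by
  unfold softmax
  rw [← Finset.sum_div]
  exact div_self (sm_Z ε y).ne'

theorem sm_le {A : Type*} [Fintype A] [Nonempty A] (ε : ℝ) (y : A → ℝ) (a : A) :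
    softmax ε y a ≤ 1 := by
  rw [← sm_sum ε y]
  exact Finset.single_le_sum (fun b _ => (sm_pos ε y b).le) (Finset.mem_univ a)

theorem sm_log {A : Type*} [Fintype A] [Nonempty A] (ε : ℝ) (y : A → ℝ) (a : A) :
    Real.log (softmax ε y a) = y a / ε - Real.log (∑ b, Real.exp (y b / ε)) := by
  unfold softmax
  rw [Real.log_div (Real.exp_pos _).ne' (sm_Z ε y).ne', Real.log_exp]

/-- **Lipschitz continuity of the softmax map.**  `σ` is `(1/ε)`-Lipschitz with
respect to the Euclidean norm:
`(∑_a (σ(y)(a) − σ(y')(a))²)^{1/2} ≤ (1/ε) (∑_a (y a − y' a)²)^{1/2}`. -/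
theorem softmax_lipschitz {A : Type*} [Fintype A] [Nonempty A]
    (ε : ℝ) (hε : 0 < ε) (y y' : A → ℝ) :
    Real.sqrt (∑ a, (softmax ε y a - softmax ε y' a) ^ 2) ≤
      (1 / ε) * Real.sqrt (∑ a, (y a - y' a) ^ 2) := by
  set d : A → ℝ := fun a => softmax ε y a - softmax ε y' a with hd
  have hd0 : ∑ a, d a = 0 := by
    simp only [hd, Finset.sum_sub_distrib, sm_sum, sub_self]
  have h1 : ∑ a, d a ^ 2 ≤ (1 / ε) * ∑ a, d a * (y a - y' a) := by
    calc ∑ a, d a ^ 2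
        ≤ ∑ a, d a * (Real.log (softmax ε y a) - Real.log (softmax ε y' a)) :=
          Finset.sum_le_sum fun a _ =>
            sm_aux _ _ (sm_pos ε y a) (sm_pos ε y' a) (sm_le ε y a) (sm_le ε y' a)
      _ = ∑ a, ((1 / ε) * (d a * (y a - y' a)) + d a *
            (Real.log (∑ b, Real.exp (y' b / ε)) - Real.log (∑ b, Real.exp (y b / ε)))) := by
          refine Finset.sum_congr rfl fun a _ => ?_
          rw [sm_log, sm_log]
          ring
      _ = _ := by
          rw [Finset.sum_add_distrib, ← Finset.sum_mul, hd0, ← Finset.mul_sum]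
          ring
  have h2 := Real.sum_mul_le_sqrt_mul_sqrt Finset.univ d (fun a => y a - y' a)
  have hS : 0 ≤ ∑ a, d a ^ 2 := Finset.sum_nonneg fun a _ => sq_nonneg _
  have h3 := Real.mul_self_sqrt hS
  have he : 0 < 1 / ε := by positivity
  have h4 := mul_le_mul_of_nonneg_left h2 he.le
  change Real.sqrt (∑ a, d a ^ 2) ≤ _
  rcases (Real.sqrt_nonneg (∑ a, d a ^ 2)).eq_or_lt with h0 | h0
  · rw [← h0]
    positivity
  · refine le_of_mul_le_mul_left ?_ h0
    rw [h3]
    refine (h1.trans h4).trans (le_of_eq ?_)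
    ring
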